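/- arXiv:1806.03745 — 7 statements merged into one kernel-verified Lean document; each statement's English description precedes it below -/
import Mathlib

section
/- Consider Model (A): X and ε are independent real-valued random variables, X ~ N(μ0, σ0²), ε ~ N(0, ω²) with σ0, ω > 0, and Y = X + ε, so that Y ~ N(μ0, σ0² + ω²). Let μ ∈ ℝ, σ > 0, and define s∧(y) = log σ + ((y − μ)² − ω²)/(2σ²) + (1/2)·log(2π). Then the pushforward of the law of Y under s∧ equals the pushforward of the standard Gaussian measure N(0,1) under the map z ↦ a∧ + b∧·(z + √λ∧)², where a∧ = log σ − ω²/(2σ²) + (1/2)·log(2π), b∧ = (σ0² + ω²)/(2σ²), and λ∧ = (μ0 − μ)²/(σ0² + ω²). -/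
open MeasureTheory ProbabilityTheory Real

/-- A real Gaussian law is the image of the standard one under any affine map with the right
mean and squared slope; the slope may be negative. -/
lemma gaussianReal_eq_map_standard (m c : ℝ) (v : NNReal) (hc : c ^ 2 = v) :
    gaussianReal m v = (gaussianReal 0 1).map (fun z => c * z + m) := by
  have hcomp : (fun z : ℝ => c * z + m) = (fun x => x + m) ∘ (fun z => c * z) := rfl
  rw [hcomp, ← Measure.map_map (by fun_prop) (by fun_prop), gaussianReal_map_const_mul,
    gaussianReal_map_add_const]
  congr 1
  · ring
  · apply NNReal.eq
    simp [hc]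

/-- A real number `d` is a signed multiple `c` of `√(d² / v)`, where `c² = v`. -/
lemma exists_sq_eq_and_mul_sqrt_div_eq (d : ℝ) {v : ℝ} (hv : 0 < v) :
    ∃ c : ℝ, c ^ 2 = v ∧ c * √(d ^ 2 / v) = d := by
  have hs : √v ≠ 0 := (Real.sqrt_pos.2 hv).ne'
  have hsq : √v ^ 2 = v := Real.sq_sqrt hv.le
  have habs : √v * √(d ^ 2 / v) = |d| := by
    rw [Real.sqrt_div (sq_nonneg d), Real.sqrt_sq_eq_abs]
    field_simp
  rcases le_total 0 d with hd | hd
  · exact ⟨√v, hsq, by rw [habs, abs_of_nonneg hd]⟩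
  · exact ⟨-√v, by rw [neg_sq, hsq], by rw [neg_mul, habs, abs_of_nonpos hd, neg_neg]⟩

/-- Proposition 2, first half: under Model (A), Ferro's corrected log score `s∧(Y)` is
distributed as `a∧ + b∧ · χ²(1, λ∧)`, where the noncentral chi-squared variable is
realized as `(Z + √λ∧)²` for `Z` standard normal. -/
theorem stmt3 {Ω : Type*} [MeasurableSpace Ω] (P : Measure Ω) [IsProbabilityMeasure P]
    (X ε : Ω → ℝ) (hX : Measurable X) (hε : Measurable ε)
    (μ0 σ0 ω : ℝ) (hσ0 : 0 < σ0) (hω : 0 < ω)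
    (hXlaw : P.map X = gaussianReal μ0 ⟨σ0 ^ 2, sq_nonneg σ0⟩)
    (hεlaw : P.map ε = gaussianReal 0 ⟨ω ^ 2, sq_nonneg ω⟩)
    (hindep : IndepFun X ε P)
    (Y : Ω → ℝ) (hY : Y = fun ω' => X ω' + ε ω')
    (μ σ : ℝ) (hσ : 0 < σ) :
    (P.map Y).map
        (fun y => Real.log σ + ((y - μ) ^ 2 - ω ^ 2) / (2 * σ ^ 2) + (1 / 2) * Real.log (2 * π))
      = (gaussianReal 0 1).map
          (fun z => (Real.log σ - ω ^ 2 / (2 * σ ^ 2) + (1 / 2) * Real.log (2 * π))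
            + ((σ0 ^ 2 + ω ^ 2) / (2 * σ ^ 2))
              * (z + Real.sqrt ((μ0 - μ) ^ 2 / (σ0 ^ 2 + ω ^ 2))) ^ 2) := by
  obtain ⟨c, hcsq, hc⟩ := exists_sq_eq_and_mul_sqrt_div_eq (μ0 - μ)
    (show 0 < σ0 ^ 2 + ω ^ 2 by positivity)
  have hYlaw : P.map Y = (gaussianReal 0 1).map (fun z => c * z + μ0) := by
    have hsum := gaussianReal_add_gaussianReal_of_indepFun hindep hXlaw hεlaw
    rw [add_zero] at hsum
    rw [hY]
    exact hsum.trans (gaussianReal_eq_map_standard μ0 c _ hcsq)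
  rw [hYlaw, Measure.map_map (by fun_prop) (by fun_prop)]
  congr 1
  funext z
  simp only [Function.comp_apply]
  rw [← hcsq] at hc ⊢
  have hshift : c * z + μ0 - μ = c * (z + √((μ0 - μ) ^ 2 / c ^ 2)) := by
    rw [mul_add, hc]
    ring
  rw [hshift]
  ring
end

section
/- Consider Model (A): X and ε are independent real-valued random variables, X ~ N(μ0, σ0²), ε ~ N(0, ω²) with σ0, ω > 0, and Y = X + ε, so that Y ~ N(μ0, σ0² + ω²). Let μ ∈ ℝ, σ > 0, and define s∨(y) = log σ + (1/(2σ²))·[ω²σ0²/(σ0² + ω²) + (ȳ − μ)²] + (1/2)·log(2π), where ȳ = (ω²·μ0 + σ0²·y)/(σ0² + ω²). Then the pushforward of the law of Y under s∨ equals the pushforward of the standard Gaussian measure N(0,1) under the map z ↦ a∨ + b∨·(z + √λ∨)², where a∨ = log σ + ω²σ0²/(2σ²(σ0² + ω²)) + (1/2)·log(2π), b∨ = ((σ0² + ω²)/(2σ²))·(σ0²/(σ0² + ω²))², and λ∨ = ((μ0 − μ)²/(σ0² + ω²))·((σ0² + ω²)/σ0²)². -/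
open MeasureTheory ProbabilityTheory Real

/-- A Gaussian law with variance `c ^ 2` is the image of the standard one under
`z ↦ m + c * z`, whatever the sign of `c`. -/
theorem gaussianReal_eq_map_affine (m c : ℝ) (v : NNReal) (hc : c ^ 2 = v) :
    gaussianReal m v = (gaussianReal 0 1).map (fun z => m + c * z) := by
  have hcomp : (fun z : ℝ => m + c * z) = (fun x => m + x) ∘ (fun z => c * z) := rfl
  rw [hcomp, ← Measure.map_map (by fun_prop) (by fun_prop), gaussianReal_map_const_mul,
    gaussianReal_map_const_add]
  congr 1
  · simp
  · ext
    simp [hc]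

/-- A positive real has a square root whose product with `a` is nonnegative. -/
theorem exists_sq_eq_and_mul_nonneg (a : ℝ) {S : ℝ} (hS : 0 ≤ S) :
    ∃ c : ℝ, c ^ 2 = S ∧ 0 ≤ a * c := by
  rcases le_total 0 a with ha | ha
  · exact ⟨√S, Real.sq_sqrt hS, mul_nonneg ha (Real.sqrt_nonneg S)⟩
  · refine ⟨-√S, by rw [neg_sq, Real.sq_sqrt hS], ?_⟩
    exact mul_nonneg_of_nonpos_of_nonpos ha (neg_nonpos.mpr (Real.sqrt_nonneg S))

/-- Proposition 2, second half: under Model (A), the corrected log score `s∨(Y)` is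
distributed as `a∨ + b∨ · χ²(1, λ∨)`, where the noncentral chi-squared variable is
realized as `(Z + √λ∨)²` for `Z` standard normal. -/
theorem stmt4 {Ω : Type*} [MeasurableSpace Ω] (P : Measure Ω) [IsProbabilityMeasure P]
    (X ε : Ω → ℝ) (hX : Measurable X) (hε : Measurable ε)
    (μ0 σ0 ω : ℝ) (hσ0 : 0 < σ0) (hω : 0 < ω)
    (hXlaw : P.map X = gaussianReal μ0 ⟨σ0 ^ 2, sq_nonneg σ0⟩)
    (hεlaw : P.map ε = gaussianReal 0 ⟨ω ^ 2, sq_nonneg ω⟩)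
    (hindep : IndepFun X ε P)
    (Y : Ω → ℝ) (hY : Y = fun ω' => X ω' + ε ω')
    (μ σ : ℝ) (hσ : 0 < σ) :
    (P.map Y).map
        (fun y => Real.log σ
          + (1 / (2 * σ ^ 2)) * (ω ^ 2 * σ0 ^ 2 / (σ0 ^ 2 + ω ^ 2)
              + ((ω ^ 2 * μ0 + σ0 ^ 2 * y) / (σ0 ^ 2 + ω ^ 2) - μ) ^ 2)
          + (1 / 2) * Real.log (2 * π))
      = (gaussianReal 0 1).map
          (fun z => (Real.log σ + ω ^ 2 * σ0 ^ 2 / (2 * σ ^ 2 * (σ0 ^ 2 + ω ^ 2))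
              + (1 / 2) * Real.log (2 * π))
            + (((σ0 ^ 2 + ω ^ 2) / (2 * σ ^ 2)) * (σ0 ^ 2 / (σ0 ^ 2 + ω ^ 2)) ^ 2)
              * (z + Real.sqrt (((μ0 - μ) ^ 2 / (σ0 ^ 2 + ω ^ 2))
                  * ((σ0 ^ 2 + ω ^ 2) / σ0 ^ 2) ^ 2)) ^ 2) := by
  have hSpos : 0 < σ0 ^ 2 + ω ^ 2 := by positivity
  have hYlaw : P.map Y = gaussianReal μ0 (⟨σ0 ^ 2, sq_nonneg σ0⟩ + ⟨ω ^ 2, sq_nonneg ω⟩) := by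
    have h := gaussianReal_add_gaussianReal_of_indepFun hindep hXlaw hεlaw
    rw [add_zero] at h
    rw [hY]
    exact h
  obtain ⟨c, hc, hac⟩ := exists_sq_eq_and_mul_nonneg (μ0 - μ) hSpos.le
  have hsqrt : Real.sqrt (((μ0 - μ) ^ 2 / (σ0 ^ 2 + ω ^ 2))
      * ((σ0 ^ 2 + ω ^ 2) / σ0 ^ 2) ^ 2) = (μ0 - μ) * c / σ0 ^ 2 := by
    have hsq : ((μ0 - μ) ^ 2 / (σ0 ^ 2 + ω ^ 2)) * ((σ0 ^ 2 + ω ^ 2) / σ0 ^ 2) ^ 2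
        = ((μ0 - μ) * c / σ0 ^ 2) ^ 2 := by
      rw [div_pow ((μ0 - μ) * c), mul_pow, hc]
      field_simp
    rw [hsq, Real.sqrt_sq (by positivity)]
  rw [hsqrt, hYlaw,
    gaussianReal_eq_map_affine μ0 c _
      (hc.trans (NNReal.coe_add ⟨σ0 ^ 2, sq_nonneg σ0⟩ ⟨ω ^ 2, sq_nonneg ω⟩).symm),
    Measure.map_map (by fun_prop) (by fun_prop)]
  congr 1
  funext z
  have hmean : ((ω ^ 2 * μ0 + σ0 ^ 2 * (μ0 + c * z)) / (σ0 ^ 2 + ω ^ 2) - μ) ^ 2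
      = (σ0 ^ 2 + ω ^ 2) * (σ0 ^ 2 / (σ0 ^ 2 + ω ^ 2)) ^ 2
        * (z + (μ0 - μ) * c / σ0 ^ 2) ^ 2 := by
    have hlin : (ω ^ 2 * μ0 + σ0 ^ 2 * (μ0 + c * z)) / (σ0 ^ 2 + ω ^ 2) - μ
        = c * (σ0 ^ 2 / (σ0 ^ 2 + ω ^ 2)) * (z + (μ0 - μ) * c / σ0 ^ 2) := by
      field_simp
      linear_combination -(μ0 - μ) * hc
    rw [hlin, mul_pow, mul_pow, hc]
  simp only [Function.comp_apply]
  rw [hmean]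
  field_simp
  ring
end

section
/- Let μ0, μ ∈ ℝ, σ0, σ, ω > 0, and let Y be a real random variable with law N(μ0, σ0² + ω²). Define s∧(y) = log σ + ((y − μ)² − ω²)/(2σ²) + (1/2)·log(2π) and s∨(y) = log σ + (1/(2σ²))·[ω²σ0²/(σ0² + ω²) + (ȳ − μ)²] + (1/2)·log(2π) with ȳ = (ω²·μ0 + σ0²·y)/(σ0² + ω²). Then Var(s∧(Y)) / Var(s∨(Y)) = (1 + 2λ∧) / (p0² + 2·p0·λ∧), where λ∧ = (μ0 − μ)²/(σ0² + ω²) and p0 = (σ0²/(σ0² + ω²))². -/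
open MeasureTheory ProbabilityTheory Real

open scoped NNReal

lemma hasDerivAt_mul_exp_gaussian_mgf {p : ℝ → ℝ} {p' t : ℝ} (m v : ℝ) (hp : HasDerivAt p p' t) :
    HasDerivAt (fun t ↦ p t * rexp (m * t + v * t ^ 2 / 2))
      ((p' + p t * (m + v * t)) * rexp (m * t + v * t ^ 2 / 2)) t := by
  have h : HasDerivAt (fun t : ℝ ↦ m * t + v * t ^ 2 / 2) (m + v * t) t := by
    refine (((hasDerivAt_id' t).const_mul m).add
      ((((hasDerivAt_id' t).pow 2).const_mul v).div_const 2)).congr_deriv ?_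
    simp
    ring
  exact (hp.mul h.exp).congr_deriv (by ring)

lemma deriv_mul_exp_gaussian_mgf {p p' : ℝ → ℝ} (m v : ℝ) (hp : ∀ t, HasDerivAt p (p' t) t) :
    deriv (fun t ↦ p t * rexp (m * t + v * t ^ 2 / 2)) =
      fun t ↦ (p' t + p t * (m + v * t)) * rexp (m * t + v * t ^ 2 / 2) :=
  funext fun t ↦ (hasDerivAt_mul_exp_gaussian_mgf m v (hp t)).deriv

lemma integral_pow_four_gaussianReal (m : ℝ) (v : ℝ≥0) :
    ∫ x, x ^ 4 ∂gaussianReal m v = m ^ 4 + 6 * m ^ 2 * v + 3 * (v : ℝ) ^ 2 := by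
  have h_affine (t : ℝ) : HasDerivAt (fun t : ℝ ↦ m + v * t) v t := by
    simpa using ((hasDerivAt_id' t).const_mul (v : ℝ)).const_add m
  have h_quadratic (t : ℝ) : HasDerivAt (fun t : ℝ ↦ v + (m + v * t) * (m + v * t))
      (2 * v * (m + v * t)) t :=
    (((h_affine t).mul (h_affine t)).const_add (v : ℝ)).congr_deriv (by ring)
  have h_cubic (t : ℝ) : HasDerivAt
      (fun t : ℝ ↦ 2 * v * (m + v * t) + (v + (m + v * t) * (m + v * t)) * (m + v * t))
      (3 * v * (v + (m + v * t) ^ 2)) t :=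
    (((h_affine t).const_mul (2 * v : ℝ)).add ((h_quadratic t).mul (h_affine t))).congr_deriv
      (by ring)
  have h₀ : mgf id (gaussianReal m v) = fun t ↦ (1 : ℝ) * rexp (m * t + v * t ^ 2 / 2) := by
    simp [mgf_id_gaussianReal]
  have h := iteratedDeriv_mgf_zero (X := id) (μ := gaussianReal m v) (by simp) 4
  rw [h₀, iteratedDeriv_eq_iterate] at h
  simp only [Function.iterate_succ, Function.iterate_zero, Function.comp_apply, id_eq] at h
  rw [deriv_mul_exp_gaussian_mgf m v (p := fun _ ↦ 1) (fun t ↦ hasDerivAt_const t 1)] at h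
  simp only [zero_add, one_mul] at h
  rw [deriv_mul_exp_gaussian_mgf m v h_affine, deriv_mul_exp_gaussian_mgf m v h_quadratic,
    deriv_mul_exp_gaussian_mgf m v h_cubic] at h
  simp at h
  rw [← h]
  ring

lemma variance_sq_gaussianReal (m : ℝ) (v : ℝ≥0) :
    Var[fun x ↦ x ^ 2; gaussianReal m v] = 2 * (v : ℝ) ^ 2 + 4 * v * m ^ 2 := by
  have h_sq : ∫ x, x ^ 2 ∂gaussianReal m v = v + m ^ 2 := by
    have h := variance_eq_sub (memLp_id_gaussianReal (μ := m) (v := v) 2)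
    simp at h
    linarith
  have h_memLp : MemLp (fun x : ℝ ↦ x ^ 2) 2 (gaussianReal m v) := by
    have h := (memLp_id_gaussianReal' (μ := m) (v := v) 4 (by simp))
    rw [memLp_two_iff_integrable_sq (by fun_prop)]
    refine (h.integrable_norm_pow (p := 4) (by simp)).congr (.of_forall fun x ↦ ?_)
    simp only [id, Real.norm_eq_abs]
    rw [← pow_mul, Even.pow_abs (by decide)]
  rw [variance_eq_sub h_memLp, h_sq]
  simp only [Pi.pow_apply, ← pow_mul]
  rw [integral_pow_four_gaussianReal]
  ring

lemma variance_const_add_mul_sq_of_hasLaw_gaussianReal {Ω : Type*} [MeasurableSpace Ω]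
    {P : Measure Ω} [IsProbabilityMeasure P] {X : Ω → ℝ} {m : ℝ} {v : ℝ≥0}
    (hX : HasLaw X (gaussianReal m v) P) (a c : ℝ) :
    Var[fun ω ↦ a + c * X ω ^ 2; P] = c ^ 2 * (2 * (v : ℝ) ^ 2 + 4 * v * m ^ 2) := by
  have h_meas := hX.aemeasurable
  rw [variance_const_add (by fun_prop), variance_const_mul, ← variance_sq_gaussianReal,
    ← hX.map_eq, variance_map (by fun_prop) h_meas, Function.comp_def]

/-- Variance ratio of the two corrected log scores under Model (A):
`Var(s∧(Y)) / Var(s∨(Y)) = (1 + 2λ∧) / (p0² + 2 p0 λ∧)`. -/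
theorem stmt5 {Ω : Type*} [MeasurableSpace Ω] (P : Measure Ω) [IsProbabilityMeasure P]
    (μ0 μ σ0 σ ω : ℝ) (hσ0 : 0 < σ0) (hσ : 0 < σ) (hω : 0 < ω)
    (Y : Ω → ℝ)
    (hYlaw : P.map Y = gaussianReal μ0 ⟨σ0 ^ 2 + ω ^ 2, by positivity⟩) :
    variance
        (fun ω' => Real.log σ + ((Y ω' - μ) ^ 2 - ω ^ 2) / (2 * σ ^ 2)
          + (1 / 2) * Real.log (2 * π)) P
      / variance
        (fun ω' => Real.log σ
          + (1 / (2 * σ ^ 2)) * (ω ^ 2 * σ0 ^ 2 / (σ0 ^ 2 + ω ^ 2)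
              + ((ω ^ 2 * μ0 + σ0 ^ 2 * Y ω') / (σ0 ^ 2 + ω ^ 2) - μ) ^ 2)
          + (1 / 2) * Real.log (2 * π)) P
      = (1 + 2 * ((μ0 - μ) ^ 2 / (σ0 ^ 2 + ω ^ 2)))
        / (((σ0 ^ 2 / (σ0 ^ 2 + ω ^ 2)) ^ 2) ^ 2
            + 2 * (σ0 ^ 2 / (σ0 ^ 2 + ω ^ 2)) ^ 2 * ((μ0 - μ) ^ 2 / (σ0 ^ 2 + ω ^ 2))) := by
  obtain ⟨v, hv, hYlaw⟩ : ∃ v : ℝ≥0, (v : ℝ) = σ0 ^ 2 + ω ^ 2 ∧ P.map Y = gaussianReal μ0 v :=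
    ⟨_, rfl, hYlaw⟩
  have hY : HasLaw Y (gaussianReal μ0 v) P :=
    ⟨aemeasurable_of_map_neZero (by rw [hYlaw]; infer_instance), hYlaw⟩
  have hs : 0 < σ0 ^ 2 + ω ^ 2 := by positivity
  have h_num := variance_const_add_mul_sq_of_hasLaw_gaussianReal (gaussianReal_sub_const hY μ)
    (Real.log σ - ω ^ 2 / (2 * σ ^ 2) + (1 / 2) * Real.log (2 * π)) (1 / (2 * σ ^ 2))
  have h_den := variance_const_add_mul_sq_of_hasLaw_gaussianReal
    (gaussianReal_add_const (gaussianReal_const_mul hY (σ0 ^ 2 / (σ0 ^ 2 + ω ^ 2)))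
      (ω ^ 2 * μ0 / (σ0 ^ 2 + ω ^ 2) - μ))
    (Real.log σ + (1 / (2 * σ ^ 2)) * (ω ^ 2 * σ0 ^ 2 / (σ0 ^ 2 + ω ^ 2))
      + (1 / 2) * Real.log (2 * π)) (1 / (2 * σ ^ 2))
  have h_mean : σ0 ^ 2 / (σ0 ^ 2 + ω ^ 2) * μ0 + (ω ^ 2 * μ0 / (σ0 ^ 2 + ω ^ 2) - μ)
      = μ0 - μ := by
    field_simp
    ring
  rw [h_mean] at h_den
  simp only [NNReal.coe_mul, NNReal.coe_mk, hv] at h_num h_den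
  convert congrArg₂ (· / ·) h_num h_den using 1
  · congr 2 <;> funext ω' <;> ring
  · field_simp
    ring
end

section
/- Let μ ∈ ℝ, σ > 0, x ∈ ℝ, and let Z and Z' be independent random variables each with law N(μ, σ²). Then E|Z − x| − (1/2)·E|Z − Z'| = x + 2σ·[φ(t) − t·(1 − Φ(t))] − (μ + σ/√π), where t = (x − μ)/σ, and φ and Φ denote the probability density function and cumulative distribution function of the standard normal distribution. -/
open MeasureTheory ProbabilityTheory Real

/-- The probability density function of the standard normal distribution. -/
noncomputable def stdNormalPDF (z : ℝ) : ℝ := (Real.sqrt (2 * π))⁻¹ * Real.exp (-z ^ 2 / 2)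

/-- The cumulative distribution function of the standard normal distribution. -/
noncomputable def stdNormalCDF (z : ℝ) : ℝ := ∫ t in Set.Iic z, stdNormalPDF t

theorem stdNormalPDF_eq_gaussianPDFReal : stdNormalPDF = gaussianPDFReal 0 1 := by
  ext z
  simp [stdNormalPDF, gaussianPDFReal_def]

theorem integral_gaussianReal_zero_one (f : ℝ → ℝ) :
    ∫ u, f u ∂gaussianReal 0 1 = ∫ u, stdNormalPDF u * f u := by
  rw [integral_gaussianReal_eq_integral_smul one_ne_zero, stdNormalPDF_eq_gaussianPDFReal]
  rfl

theorem integrable_stdNormalPDF : Integrable stdNormalPDF := by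
  rw [stdNormalPDF_eq_gaussianPDFReal]
  exact integrable_gaussianPDFReal 0 1

theorem integral_stdNormalPDF : ∫ u, stdNormalPDF u = 1 := by
  rw [stdNormalPDF_eq_gaussianPDFReal]
  exact integral_gaussianPDFReal_eq_one 0 one_ne_zero

theorem integrable_stdNormalPDF_mul_id : Integrable fun u ↦ stdNormalPDF u * u := by
  refine ((integrable_mul_exp_neg_mul_sq (b := 1 / 2) (by norm_num)).const_mul
    (√(2 * π))⁻¹).congr (.of_forall fun u ↦ ?_)
  simp only [stdNormalPDF]
  rw [show -(1 / 2) * u ^ 2 = -u ^ 2 / 2 by ring]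
  ring

theorem integral_stdNormalPDF_mul_id : ∫ u, stdNormalPDF u * u = 0 := by
  rw [← integral_gaussianReal_zero_one fun u ↦ u, integral_id_gaussianReal]

theorem hasDerivAt_neg_stdNormalPDF (u : ℝ) :
    HasDerivAt (fun z ↦ -stdNormalPDF z) (stdNormalPDF u * u) u := by
  have h : HasDerivAt (fun z : ℝ ↦ -z ^ 2 / 2) (-u) u := by
    refine ((hasDerivAt_pow 2 u).fun_neg.div_const 2).congr_deriv ?_
    norm_num
    ring
  refine (h.exp.const_mul (√(2 * π))⁻¹).fun_neg.congr_deriv ?_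
  simp only [stdNormalPDF]
  ring

theorem tendsto_stdNormalPDF_atBot : Filter.Tendsto stdNormalPDF Filter.atBot (nhds 0) := by
  have h : Filter.Tendsto (fun z : ℝ ↦ z ^ 2 / 2) Filter.atBot Filter.atTop :=
    (Filter.tendsto_pow_atTop two_ne_zero).comp Filter.tendsto_abs_atBot_atTop
      |>.atTop_div_const two_pos |>.congr fun z ↦ by simp
  have hlim := (tendsto_exp_neg_atTop_nhds_zero.comp h).const_mul (√(2 * π))⁻¹
  rw [mul_zero] at hlim
  exact hlim.congr fun z ↦ by simp [stdNormalPDF, neg_div]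

theorem setIntegral_Iic_stdNormalPDF_mul_id (t : ℝ) :
    ∫ u in Set.Iic t, stdNormalPDF u * u = -stdNormalPDF t := by
  simpa using integral_Iic_of_hasDerivAt_of_tendsto'
    (fun u _ ↦ hasDerivAt_neg_stdNormalPDF u) integrable_stdNormalPDF_mul_id.integrableOn
    tendsto_stdNormalPDF_atBot.neg

theorem integral_abs_sub_gaussianReal_zero_one (t : ℝ) :
    ∫ u, |u - t| ∂gaussianReal 0 1 = 2 * stdNormalPDF t + t * (2 * stdNormalCDF t - 1) := by
  have hint := integrable_stdNormalPDF_mul_id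
  have hint' := integrable_stdNormalPDF.const_mul t
  have hsplit (u : ℝ) : stdNormalPDF u * |u - t| = (stdNormalPDF u * u - t * stdNormalPDF u) +
      2 * (Set.Iic t).indicator (fun u ↦ t * stdNormalPDF u - stdNormalPDF u * u) u := by
    by_cases hu : u ≤ t
    · rw [Set.indicator_of_mem (Set.mem_Iic.2 hu), abs_of_nonpos (sub_nonpos.2 hu)]
      ring
    · rw [Set.indicator_of_notMem (by simpa using hu), abs_of_pos (by linarith)]
      ring
  rw [integral_gaussianReal_zero_one]
  simp_rw [hsplit]
  rw [integral_add (by exact hint.sub hint')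
      (by exact ((hint'.sub hint).indicator measurableSet_Iic).const_mul 2),
    integral_sub hint hint', integral_const_mul, integral_const_mul,
    integral_indicator measurableSet_Iic, integral_sub hint'.integrableOn hint.integrableOn,
    integral_const_mul, setIntegral_Iic_stdNormalPDF_mul_id, integral_stdNormalPDF_mul_id,
    integral_stdNormalPDF, ← stdNormalCDF]
  ring

theorem integral_abs_sub_gaussianReal (μ x : ℝ) {σ : NNReal} (hσ : 0 < σ) :
    ∫ z, |z - x| ∂gaussianReal μ (σ ^ 2) =
      σ * (2 * stdNormalPDF ((x - μ) / σ)
        + (x - μ) / σ * (2 * stdNormalCDF ((x - μ) / σ) - 1)) := by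
  have hmap : (gaussianReal 0 1).map (fun u ↦ σ * u + μ) = gaussianReal μ (σ ^ 2) := by
    have h := Measure.map_map (μ := gaussianReal 0 1) (g := fun u ↦ u + μ)
      (f := fun u ↦ (σ : ℝ) * u) (by fun_prop) (by fun_prop)
    rw [gaussianReal_map_const_mul, gaussianReal_map_add_const, mul_zero, zero_add, mul_one] at h
    exact h.symm
  have hσ' : (0 : ℝ) < σ := hσ
  rw [← hmap, integral_map (by fun_prop) (by fun_prop), ← integral_abs_sub_gaussianReal_zero_one,
    ← integral_const_mul]
  congr 1 with u
  nth_rw 2 [← abs_of_pos hσ']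
  rw [← abs_mul]
  congr 1
  field_simp
  ring

theorem integral_abs_sub_of_indepFun_gaussianReal {Ω : Type*} [MeasurableSpace Ω] {P : Measure Ω}
    {Z Z' : Ω → ℝ} {μ : ℝ} {σ : NNReal} (hσ : 0 < σ)
    (hZ : HasLaw Z (gaussianReal μ (σ ^ 2)) P) (hZ' : HasLaw Z' (gaussianReal μ (σ ^ 2)) P)
    (hindep : IndepFun Z Z' P) :
    ∫ ω, |Z ω - Z' ω| ∂P = 2 * σ / √π := by
  have hneg := gaussianReal_neg hZ'
  have hsum := gaussianReal_add_gaussianReal_of_indepFun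
    (X := Z) (Y := -Z')
    (hindep.comp measurable_id measurable_neg) hZ.map_eq hneg.map_eq
  have hvar : σ ^ 2 + σ ^ 2 = (NNReal.sqrt 2 * σ) ^ 2 := by
    rw [mul_pow, NNReal.sq_sqrt, two_mul]
  rw [hvar, add_neg_cancel] at hsum
  have h := integral_abs_sub_gaussianReal 0 0 (σ := NNReal.sqrt 2 * σ) (by positivity)
  rw [← hsum, integral_map (hZ.aemeasurable.add hneg.aemeasurable) (by fun_prop)] at h
  simp only [Pi.add_apply, Pi.neg_apply, sub_zero, ← sub_eq_add_neg, zero_div, zero_mul,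
    add_zero] at h
  rw [h]
  have hpi : √π ≠ 0 := (sqrt_pos.2 pi_pos).ne'
  simp only [stdNormalPDF, sqrt_mul zero_le_two, NNReal.coe_mul, Real.coe_sqrt, NNReal.coe_ofNat]
  field_simp
  simp

/-- Closed form of the CRPS of a Gaussian forecast `N(μ, σ²)` at a point `x`. -/
theorem stmt6 {Ω : Type*} [MeasurableSpace Ω] (P : Measure Ω) [IsProbabilityMeasure P]
    (Z Z' : Ω → ℝ) (μ σ x : ℝ) (hσ : 0 < σ)
    (hZ : P.map Z = gaussianReal μ ⟨σ ^ 2, sq_nonneg σ⟩)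
    (hZ' : P.map Z' = gaussianReal μ ⟨σ ^ 2, sq_nonneg σ⟩)
    (hindep : IndepFun Z Z' P) :
    (∫ ω, |Z ω - x| ∂P) - (1 / 2) * ∫ ω, |Z ω - Z' ω| ∂P
      = x + 2 * σ * (stdNormalPDF ((x - μ) / σ)
            - ((x - μ) / σ) * (1 - stdNormalCDF ((x - μ) / σ)))
        - (μ + σ / Real.sqrt π) := by
  lift σ to NNReal using hσ.le
  have hZ : HasLaw Z (gaussianReal μ (σ ^ 2)) P :=
    ⟨.of_map_ne_zero (hZ ▸ IsProbabilityMeasure.ne_zero (gaussianReal μ (σ ^ 2))), hZ⟩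
  have hZ' : HasLaw Z' (gaussianReal μ (σ ^ 2)) P :=
    ⟨.of_map_ne_zero (hZ' ▸ IsProbabilityMeasure.ne_zero (gaussianReal μ (σ ^ 2))), hZ'⟩
  have h := integral_abs_sub_gaussianReal μ x (σ := σ) hσ
  rw [← hZ.map_eq, integral_map hZ.aemeasurable (by fun_prop)] at h
  rw [h, integral_abs_sub_of_indepFun_gaussianReal hσ hZ hZ' hindep]
  field_simp
  ring
end

section
/- Let Z and Z' be independent, identically distributed, integrable real random variables whose common cumulative distribution function F is continuous. Then (1/2)·E|Z − Z'| = E[Z·(2·F(Z) − 1)]. -/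
open MeasureTheory ProbabilityTheory

/-- A probability measure on `ℝ` with continuous cumulative distribution function has no atoms. -/
theorem nullSingletonClass_of_continuous_cdf (μ : Measure ℝ) [IsProbabilityMeasure μ]
    (h : Continuous (cdf μ)) : NullSingletonClass μ := by
  refine ⟨fun x => ?_⟩
  rw [← measure_cdf μ, StieltjesFunction.measure_singleton,
    h.continuousWithinAt.leftLim_eq, sub_self, ENNReal.ofReal_zero]

theorem integral_two_mul_indicator_sub_one {α : Type*} [MeasurableSpace α] (μ : Measure α)
    [IsProbabilityMeasure μ] {s : Set α} (hs : MeasurableSet s) :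
    ∫ x, (2 * s.indicator (fun _ => (1 : ℝ)) x - 1) ∂μ = 2 * μ.real s - 1 := by
  rw [integral_sub (((integrable_const 1).indicator hs).const_mul 2) (integrable_const 1),
    integral_const_mul, integral_indicator_const _ hs]
  simp

/-- The Gini mean difference of an atomless probability measure as a single expectation. -/
theorem integral_abs_sub_prod_self (μ : Measure ℝ) [IsProbabilityMeasure μ] [NullSingletonClass μ]
    (hμ : Integrable (fun x => x) μ) :
    ∫ p : ℝ × ℝ, |p.1 - p.2| ∂(μ.prod μ) = 2 * ∫ x, x * (2 * μ.real (Set.Iic x) - 1) ∂μ := by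
  set s : ℝ × ℝ → ℝ :=
    fun p => 2 * {q : ℝ × ℝ | q.2 ≤ q.1}.indicator (fun _ => (1 : ℝ)) p - 1 with hs
  have hms : Measurable s :=
    ((measurable_const.indicator (measurableSet_le measurable_snd measurable_fst)).const_mul
      2).sub_const 1
  have hbound : ∀ p, ‖s p‖ ≤ 1 := fun p => by
    by_cases hp : p.2 ≤ p.1 <;> simp [hs, hp] <;> norm_num
  have habs : ∀ p : ℝ × ℝ, |p.1 - p.2| = p.1 * s p - p.2 * s p := fun p => by
    by_cases hp : p.2 ≤ p.1
    · rw [abs_of_nonneg (by linarith)]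
      simp [hs, hp]
      ring
    · rw [abs_of_neg (by linarith)]
      simp [hs, hp]
      ring
  have h1 : Integrable (fun p : ℝ × ℝ => p.1 * s p) (μ.prod μ) :=
    (hμ.comp_fst μ).mul_bdd (c := 1) hms.aestronglyMeasurable (ae_of_all _ hbound)
  have h2 : Integrable (fun p : ℝ × ℝ => p.2 * s p) (μ.prod μ) :=
    (hμ.comp_snd μ).mul_bdd (c := 1) hms.aestronglyMeasurable (ae_of_all _ hbound)
  have hfst (x : ℝ) : ∫ y, x * s (x, y) ∂μ = x * (2 * μ.real (Set.Iic x) - 1) := by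
    rw [integral_const_mul]
    exact congrArg (x * ·) (integral_two_mul_indicator_sub_one μ measurableSet_Iic)
  have hsnd (y : ℝ) : ∫ x, y * s (x, y) ∂μ = -(y * (2 * μ.real (Set.Iic y) - 1)) := by
    have hIci : μ.real (Set.Ici y) = 1 - μ.real (Set.Iic y) := by
      rw [← measureReal_congr (Iio_ae_eq_Iic (μ := μ) (a := y)),
        ← probReal_compl_eq_one_sub measurableSet_Iio, Set.compl_Iio]
    rw [integral_const_mul]
    refine (congrArg (y * ·) (integral_two_mul_indicator_sub_one μ measurableSet_Ici)).trans ?_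
    simp only [hIci]
    ring
  simp_rw [habs]
  rw [integral_sub h1 h2, integral_prod _ h1, integral_prod_symm _ h2]
  simp only [hfst, hsnd, integral_neg]
  ring

/-- For iid integrable real random variables `Z, Z'` with continuous common cdf `F`,
`(1/2)·E|Z − Z'| = E[Z·(2·F(Z) − 1)]`. -/
theorem stmt8 {Ω : Type*} [MeasurableSpace Ω] (P : Measure Ω) [IsProbabilityMeasure P]
    (Z Z' : Ω → ℝ) (hZmeas : Measurable Z) (hZ'meas : Measurable Z')
    (hZint : Integrable Z P) (hZ'int : Integrable Z' P)
    (hlaw : P.map Z = P.map Z') (hindep : IndepFun Z Z' P)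
    (F : ℝ → ℝ) (hF : F = fun x => ((P.map Z) (Set.Iic x)).toReal)
    (hFcont : Continuous F) :
    (1 / 2) * ∫ ω, |Z ω - Z' ω| ∂P = ∫ ω, Z ω * (2 * F (Z ω) - 1) ∂P := by
  have : IsProbabilityMeasure (P.map Z) := Measure.isProbabilityMeasure_map hZmeas.aemeasurable
  have hcdf : ⇑(cdf (P.map Z)) = F := by
    ext x
    rw [cdf_eq_real, hF]
    rfl
  have : NullSingletonClass (P.map Z) := nullSingletonClass_of_continuous_cdf _ (hcdf ▸ hFcont)
  have hint : Integrable (fun x => x) (P.map Z) :=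
    (integrable_map_measure measurable_id.aestronglyMeasurable hZmeas.aemeasurable).2 hZint
  have hprod : P.map (fun ω => (Z ω, Z' ω)) = (P.map Z).prod (P.map Z) := by
    rw [(indepFun_iff_map_prod_eq_prod_map_map hZmeas.aemeasurable hZ'meas.aemeasurable).1 hindep,
      ← hlaw]
  have hleft : ∫ ω, |Z ω - Z' ω| ∂P = ∫ p : ℝ × ℝ, |p.1 - p.2| ∂((P.map Z).prod (P.map Z)) := by
    rw [← hprod, integral_map (hZmeas.prodMk hZ'meas).aemeasurable
      (by fun_prop : Continuous fun p : ℝ × ℝ => |p.1 - p.2|).aestronglyMeasurable]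
  have hright : ∫ ω, Z ω * (2 * F (Z ω) - 1) ∂P = ∫ x, x * (2 * F x - 1) ∂(P.map Z) := by
    rw [integral_map hZmeas.aemeasurable
      (by fun_prop : Continuous fun x => x * (2 * F x - 1)).aestronglyMeasurable]
  rw [hleft, hright, integral_abs_sub_prod_self _ hint, ← hcdf]
  simp only [cdf_eq_real]
  ring
end

section
/- Consider Model (B): X and ε are independent positive random variables, X with gamma density β0^{α0}/Γ(α0)·x^{α0−1}·exp(−β0·x) on (0,∞) (α0, β0 > 0), ε with inverse-gamma density b^a/Γ(a)·u^{−a−1}·exp(−b/u) on (0,∞) (a, b > 0), and Y = X·ε. Let α, β > 0 and define the gamma-forecast logarithmic score s0(x) = (1 − α)·log x + β·x − α·log β + log Γ(α). Then, almost surely, E[s0(X) | σ(Y)] = (1 − α)·(ψ(α0 + a) − log(β0 + b/Y)) + β·(α0 + a)/(β0 + b/Y) − α·log β + log Γ(α), where ψ is the digamma function, the derivative of x ↦ log Γ(x). -/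
open MeasureTheory ProbabilityTheory Real

theorem measurable_gammaPDF (A r : ℝ) : Measurable (gammaPDF A r) := by
  unfold gammaPDF
  fun_prop

theorem ae_pos_gammaMeasure (A r : ℝ) : ∀ᵐ x ∂gammaMeasure A r, 0 < x := by
  rw [gammaMeasure, ae_withDensity_iff (measurable_gammaPDF A r)]
  filter_upwards [Measure.ae_ne volume (0 : ℝ)] with x hx0 hx
  by_contra h
  exact hx (gammaPDF_of_neg (lt_of_le_of_ne (not_lt.mp h) hx0))

theorem lintegral_rpow_gammaMeasure {A r t : ℝ} (hA : 0 < A) (hr : 0 < r) (ht : 0 < A + t) :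
    ∫⁻ x, ENNReal.ofReal (x ^ t) ∂gammaMeasure A r =
      ENNReal.ofReal (Gamma (A + t) / (Gamma A * r ^ t)) := by
  have hΓ := Gamma_pos_of_pos hA
  have hΓt := Gamma_pos_of_pos ht
  rw [gammaMeasure, lintegral_withDensity_eq_lintegral_mul _ (measurable_gammaPDF A r) (by fun_prop)]
  calc
    _ = ∫⁻ x, ENNReal.ofReal (Gamma (A + t) / (Gamma A * r ^ t)) * gammaPDF (A + t) r x := by
      refine lintegral_congr_ae ?_
      filter_upwards [Measure.ae_ne volume (0 : ℝ)] with x hx0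
      rcases lt_or_gt_of_ne hx0 with hx | hx
      · simp [gammaPDF_of_neg hx]
      · rw [Pi.mul_apply, gammaPDF_of_nonneg hx.le, gammaPDF_of_nonneg hx.le,
          ← ENNReal.ofReal_mul (by positivity), ← ENNReal.ofReal_mul (by positivity),
          show A + t - 1 = (A - 1) + t by ring, rpow_add hx, rpow_add hr]
        congr 1
        have := rpow_pos_of_pos hr t
        field_simp
    _ = _ := by
      rw [lintegral_const_mul _ (measurable_gammaPDF _ _), lintegral_gammaPDF_eq_one ht hr, mul_one]

theorem integrable_rpow_gammaMeasure {A r t : ℝ} (hA : 0 < A) (hr : 0 < r) (ht : 0 < A + t) :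
    Integrable (fun x => x ^ t) (gammaMeasure A r) := by
  refine ⟨by fun_prop, ?_⟩
  rw [hasFiniteIntegral_iff_ofReal, lintegral_rpow_gammaMeasure hA hr ht]
  · exact ENNReal.ofReal_lt_top
  · filter_upwards [ae_pos_gammaMeasure A r] with x hx using rpow_nonneg hx.le t

theorem integral_rpow_gammaMeasure {A r t : ℝ} (hA : 0 < A) (hr : 0 < r) (ht : 0 < A + t) :
    ∫ x, x ^ t ∂gammaMeasure A r = Gamma (A + t) / (Gamma A * r ^ t) := by
  have hΓ := Gamma_pos_of_pos hA
  have hΓt := Gamma_pos_of_pos ht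
  rw [integral_eq_lintegral_of_nonneg_ae _ (by fun_prop), lintegral_rpow_gammaMeasure hA hr ht,
    ENNReal.toReal_ofReal (by positivity)]
  filter_upwards [ae_pos_gammaMeasure A r] with x hx using rpow_nonneg hx.le t

theorem integrable_id_gammaMeasure {A r : ℝ} (hA : 0 < A) (hr : 0 < r) :
    Integrable (fun x => x) (gammaMeasure A r) := by
  simpa using integrable_rpow_gammaMeasure (t := 1) hA hr (by linarith)

theorem integral_id_gammaMeasure {A r : ℝ} (hA : 0 < A) (hr : 0 < r) :
    ∫ x, x ∂gammaMeasure A r = A / r := by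
  have h := integral_rpow_gammaMeasure (t := 1) hA hr (by linarith)
  have hΓ := Gamma_pos_of_pos hA
  simp only [rpow_one, Gamma_add_one hA.ne'] at h
  rw [h]
  field_simp

theorem exp_mul_log_ae_eq_rpow_gammaMeasure (A r t : ℝ) :
    (fun x => exp (t * log x)) =ᵐ[gammaMeasure A r] fun x => x ^ t := by
  filter_upwards [ae_pos_gammaMeasure A r] with x hx
  rw [rpow_def_of_pos hx, mul_comm]

theorem zero_mem_interior_integrableExpSet_log_gammaMeasure {A r : ℝ} (hA : 0 < A) (hr : 0 < r) :
    0 ∈ interior (integrableExpSet log (gammaMeasure A r)) := by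
  refine mem_interior.mpr ⟨Set.Ioi (-A), fun t ht => ?_, isOpen_Ioi, by simpa using hA⟩
  have ht : -A < t := ht
  exact (integrable_rpow_gammaMeasure hA hr (by linarith)).congr
    (exp_mul_log_ae_eq_rpow_gammaMeasure A r t).symm

theorem integrable_log_gammaMeasure {A r : ℝ} (hA : 0 < A) (hr : 0 < r) :
    Integrable log (gammaMeasure A r) :=
  integrable_of_mem_interior_integrableExpSet
    (zero_mem_interior_integrableExpSet_log_gammaMeasure hA hr)

theorem cgf_log_gammaMeasure {A r t : ℝ} (hA : 0 < A) (hr : 0 < r) (ht : 0 < A + t) :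
    cgf log (gammaMeasure A r) t = log (Gamma (A + t)) - log (Gamma A) - t * log r := by
  have hΓ := Gamma_pos_of_pos hA
  have hΓt := Gamma_pos_of_pos ht
  have hrt := rpow_pos_of_pos hr t
  rw [cgf, mgf, integral_congr_ae (exp_mul_log_ae_eq_rpow_gammaMeasure A r t),
    integral_rpow_gammaMeasure hA hr ht, log_div hΓt.ne' (by positivity),
    log_mul hΓ.ne' hrt.ne', log_rpow hr]
  ring

theorem integral_log_gammaMeasure {A r : ℝ} (hA : 0 < A) (hr : 0 < r) :
    ∫ x, log x ∂gammaMeasure A r = deriv (fun x => log (Gamma x)) A - log r := by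
  have := isProbabilityMeasure_gammaMeasure hA hr
  have hcgf := deriv_cgf_zero (zero_mem_interior_integrableExpSet_log_gammaMeasure hA hr)
  rw [probReal_univ, div_one] at hcgf
  rw [← hcgf]
  have heq : cgf log (gammaMeasure A r) =ᶠ[nhds 0]
      fun t => log (Gamma (A + t)) - log (Gamma A) - t * log r := by
    filter_upwards [Ioi_mem_nhds (neg_lt_zero.mpr hA)] with t ht
    exact cgf_log_gammaMeasure hA hr (by linarith [Set.mem_Ioi.mp ht])
  have hdiff : DifferentiableAt ℝ (fun x => log (Gamma x)) (A + 0) := by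
    rw [add_zero]
    exact (differentiableOn_Gamma_Ioi.differentiableAt (Ioi_mem_nhds hA)).log
      (Gamma_pos_of_pos hA).ne'
  have hderiv : HasDerivAt (fun t => log (Gamma (A + t)) - log (Gamma A) - t * log r)
      (deriv (fun x => log (Gamma x)) (A + 0) - 1 * log r) 0 :=
    ((hdiff.hasDerivAt.comp_const_add A 0).sub_const (log (Gamma A))).sub
      ((hasDerivAt_id (0 : ℝ)).mul_const (log r))
  rw [heq.deriv_eq]
  simpa using hderiv.deriv

theorem integrable_gammaScore_gammaMeasure {A r : ℝ} (hA : 0 < A) (hr : 0 < r) (α β : ℝ) :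
    Integrable (fun x => (1 - α) * log x + β * x - α * log β + log (Gamma α))
      (gammaMeasure A r) := by
  have := isProbabilityMeasure_gammaMeasure hA hr
  exact ((((integrable_log_gammaMeasure hA hr).const_mul _).add
    ((integrable_id_gammaMeasure hA hr).const_mul _)).sub (integrable_const _)).add
    (integrable_const _)

theorem integral_gammaScore_gammaMeasure {A r : ℝ} (hA : 0 < A) (hr : 0 < r) (α β : ℝ) :
    ∫ x, ((1 - α) * log x + β * x - α * log β + log (Gamma α)) ∂gammaMeasure A r =
      (1 - α) * (deriv (fun x => log (Gamma x)) A - log r) + β * A / r - α * log β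
        + log (Gamma α) := by
  have := isProbabilityMeasure_gammaMeasure hA hr
  have hlog := (integrable_log_gammaMeasure hA hr).const_mul (1 - α)
  have hid := (integrable_id_gammaMeasure hA hr).const_mul β
  have hlogid : Integrable (fun x => (1 - α) * log x + β * x) (gammaMeasure A r) := hlog.add hid
  have hsub : Integrable (fun x => (1 - α) * log x + β * x - α * log β) (gammaMeasure A r) :=
    hlogid.sub (integrable_const _)
  rw [integral_add hsub (integrable_const _),
    integral_sub hlogid (integrable_const _), integral_add hlog hid,
    integral_const_mul, integral_const_mul, integral_log_gammaMeasure hA hr,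
    integral_id_gammaMeasure hA hr]
  simp [mul_div_assoc]

/-- The kernel `y ↦ Gamma(A, β + b / |y|)`; the absolute value keeps the rate positive for every
`y`, which makes this a Markov kernel on all of `ℝ`. -/
noncomputable def gammaKernel (A β b : ℝ) : Kernel ℝ ℝ :=
  Kernel.withDensity (Kernel.const ℝ volume) fun y x => gammaPDF A (β + b / |y|) x

theorem measurable_gammaPDF_rate (A β b : ℝ) :
    Measurable (Function.uncurry fun y x : ℝ => gammaPDF A (β + b / |y|) x) := by
  unfold gammaPDF gammaPDFReal Function.uncurry
  refine ENNReal.measurable_ofReal.comp (Measurable.ite ?_ (by fun_prop) (by fun_prop))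
  exact measurableSet_le measurable_const measurable_snd

theorem gammaKernel_apply (A β b y : ℝ) :
    gammaKernel A β b y = gammaMeasure A (β + b / |y|) := by
  rw [gammaKernel, Kernel.withDensity_apply _ (measurable_gammaPDF_rate A β b),
    Kernel.const_apply, gammaMeasure]

theorem isMarkovKernel_gammaKernel {A β b : ℝ} (hA : 0 < A) (hβ : 0 < β) (hb : 0 < b) :
    IsMarkovKernel (gammaKernel A β b) :=
  ⟨fun y => by
    rw [gammaKernel_apply]
    exact isProbabilityMeasure_gammaMeasure hA (by positivity)⟩

/-- The inverse-gamma density with shape `a` and scale `b`. -/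
noncomputable def inverseGammaPDF (a b u : ℝ) : ENNReal :=
  ENNReal.ofReal (if 0 < u then b ^ a / Gamma a * u ^ (-a - 1) * exp (-b / u) else 0)

theorem measurable_inverseGammaPDF (a b : ℝ) : Measurable (inverseGammaPDF a b) := by
  unfold inverseGammaPDF
  exact ENNReal.measurable_ofReal.comp
    (Measurable.ite measurableSet_Ioi (by fun_prop) (by fun_prop))

/-- The density of the product of independent gamma and inverse-gamma variables. -/
noncomputable def gammaMulInverseGammaPDF (α β a b y : ℝ) : ENNReal :=
  ENNReal.ofReal (if 0 < y then
    β ^ α * b ^ a * Gamma (α + a) / (Gamma α * Gamma a) * y ^ (-a - 1)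
      / (β + b / y) ^ (α + a) else 0)

theorem measurable_gammaMulInverseGammaPDF (α β a b : ℝ) :
    Measurable (gammaMulInverseGammaPDF α β a b) := by
  unfold gammaMulInverseGammaPDF
  exact ENNReal.measurable_ofReal.comp
    (Measurable.ite measurableSet_Ioi (by fun_prop) (by fun_prop))

theorem gammaPDF_mul_inverseGammaPDF {α β a b x : ℝ} (hα : 0 < α) (hβ : 0 < β) (ha : 0 < a)
    (hb : 0 < b) (hx0 : x ≠ 0) (y : ℝ) :
    gammaPDF α β x * (ENNReal.ofReal |x⁻¹| * inverseGammaPDF a b (x⁻¹ * y)) =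
      gammaMulInverseGammaPDF α β a b y * gammaPDF (α + a) (β + b / |y|) x := by
  rcases lt_or_gt_of_ne hx0 with hx | hx
  · simp [gammaPDF_of_neg hx]
  by_cases hy : 0 < y
  · have hxy : 0 < x⁻¹ * y := by positivity
    have hr : 0 < β + b / y := by positivity
    have hΓα := Gamma_pos_of_pos hα
    have hΓa := Gamma_pos_of_pos ha
    have hΓ := Gamma_pos_of_pos (add_pos hα ha)
    rw [inverseGammaPDF, gammaMulInverseGammaPDF, if_pos hy, if_pos hxy, abs_of_pos hy,
      abs_of_pos (inv_pos.mpr hx), gammaPDF_of_nonneg hx.le, gammaPDF_of_nonneg hx.le,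
      ← ENNReal.ofReal_mul (by positivity), ← ENNReal.ofReal_mul (by positivity),
      ← ENNReal.ofReal_mul (by positivity)]
    congr 1
    have hexp : exp (-((β + b / y) * x)) = exp (-(β * x)) * exp (-b / (x⁻¹ * y)) := by
      rw [← exp_add]
      congr 1
      field_simp
      ring
    have hpow : x ^ (α + a - 1) = x ^ (α - 1) * (x⁻¹ * x⁻¹ ^ (-a - 1)) := by
      rw [inv_rpow hx.le, ← rpow_neg hx.le, ← rpow_neg_one x, ← rpow_add hx, ← rpow_add hx]
      congr 1
      ring
    have hrpow := rpow_pos_of_pos hr (α + a)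
    rw [hexp, hpow, mul_rpow (inv_pos.mpr hx).le hy.le]
    field_simp
  · have hxy : ¬ 0 < x⁻¹ * y := by
      rw [mul_pos_iff_of_pos_left (inv_pos.mpr hx)]
      exact hy
    simp [inverseGammaPDF, gammaMulInverseGammaPDF, hy, hxy]

theorem lintegral_comp_mul_left_mul {x : ℝ} (hx : x ≠ 0) {F f : ℝ → ENNReal}
    (hF : Measurable F) (hf : Measurable f) :
    ∫⁻ u, f u * F (x * u) = ∫⁻ y, ENNReal.ofReal |x⁻¹| * f (x⁻¹ * y) * F y := by
  have hmap := lintegral_map (μ := volume) (f := fun y => f (x⁻¹ * y) * F y) (by fun_prop)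
    (measurable_const_mul x)
  simp_rw [inv_mul_cancel_left₀ hx] at hmap
  rw [← hmap, map_volume_mul_left hx, lintegral_smul_measure, smul_eq_mul,
    ← lintegral_const_mul _ (by fun_prop)]
  simp_rw [mul_assoc]

theorem map_prod_gamma_inverseGamma {α β a b : ℝ} (hα : 0 < α) (hβ : 0 < β) (ha : 0 < a)
    (hb : 0 < b) :
    ((gammaMeasure α β).prod (volume.withDensity (inverseGammaPDF a b))).map
        (fun p => (p.1 * p.2, p.1)) =
      (volume.withDensity (gammaMulInverseGammaPDF α β a b)) ⊗ₘ gammaKernel (α + a) β b := by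
  have := isMarkovKernel_gammaKernel (add_pos hα ha) hβ hb
  have hfX := measurable_gammaPDF α β
  have hfε := measurable_inverseGammaPDF a b
  have hm := measurable_gammaMulInverseGammaPDF α β a b
  have hκ := measurable_gammaPDF_rate (α + a) β b
  refine Measure.ext_of_lintegral _ fun F hF => ?_
  have hFX : Measurable fun x =>
      ∫⁻ u, F (x * u, x) ∂volume.withDensity (inverseGammaPDF a b) :=
    Measurable.lintegral_prod_right' (f := fun p : ℝ × ℝ => F (p.1 * p.2, p.1)) (by fun_prop)
  rw [lintegral_map hF (by fun_prop), lintegral_prod _ (by fun_prop),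
    Measure.lintegral_compProd hF, gammaMeasure,
    lintegral_withDensity_eq_lintegral_mul _ hfX hFX,
    lintegral_withDensity_eq_lintegral_mul _ hm (Measurable.lintegral_kernel_prod_right' hF)]
  calc
    _ = ∫⁻ x, ∫⁻ y, gammaMulInverseGammaPDF α β a b y *
          (gammaPDF (α + a) (β + b / |y|) x * F (y, x)) := by
      refine lintegral_congr_ae ?_
      filter_upwards [Measure.ae_ne volume (0 : ℝ)] with x hx
      rw [Pi.mul_apply, lintegral_withDensity_eq_lintegral_mul _ hfε (by fun_prop)]
      simp only [Pi.mul_apply]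
      rw [lintegral_comp_mul_left_mul hx (F := fun y => F (y, x)) (by fun_prop) hfε,
        ← lintegral_const_mul _ (by fun_prop)]
      refine lintegral_congr fun y => ?_
      rw [← mul_assoc, gammaPDF_mul_inverseGammaPDF hα hβ ha hb hx, mul_assoc]
    _ = ∫⁻ y, ∫⁻ x, gammaMulInverseGammaPDF α β a b y *
          (gammaPDF (α + a) (β + b / |y|) x * F (y, x)) := by
      refine lintegral_lintegral_swap (Measurable.aemeasurable ?_)
      exact (hm.comp measurable_snd).mul ((hκ.comp measurable_swap).mul (hF.comp measurable_swap))
    _ = _ := by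
      refine lintegral_congr fun y => ?_
      have hκy := measurable_gammaPDF (α + a) (β + b / |y|)
      rw [Pi.mul_apply, lintegral_const_mul _ (by fun_prop), gammaKernel_apply, gammaMeasure,
        lintegral_withDensity_eq_lintegral_mul _ hκy (by fun_prop)]
      rfl


/-- Proposition 4: under Model (B), the conditional expectation given `σ(Y)` of the
gamma-forecast log score `s0(X)` equals
`(1 − α)·(ψ(α0 + a) − log(β0 + b/Y)) + β·(α0 + a)/(β0 + b/Y) − α·log β + log Γ(α)`,
where `ψ` is the digamma function (the derivative of `log ∘ Γ`). -/
theorem stmt16 {Ω : Type*} [MeasurableSpace Ω] (P : Measure Ω) [IsProbabilityMeasure P]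
    (X ε : Ω → ℝ) (hX : Measurable X) (hε : Measurable ε)
    (α0 β0 a b : ℝ) (hα0 : 0 < α0) (hβ0 : 0 < β0) (ha : 0 < a) (hb : 0 < b)
    (hXlaw : P.map X = gammaMeasure α0 β0)
    (hεlaw : P.map ε = volume.withDensity
      (fun u => ENNReal.ofReal
        (if 0 < u then b ^ a / Real.Gamma a * u ^ (-a - 1) * Real.exp (-b / u) else 0)))
    (hindep : IndepFun X ε P)
    (Y : Ω → ℝ) (hY : Y = fun ω' => X ω' * ε ω')
    (α β : ℝ) (hα : 0 < α) (hβ : 0 < β)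
    (s0 : ℝ → ℝ)
    (hs0 : s0 = fun x => (1 - α) * Real.log x + β * x - α * Real.log β
      + Real.log (Real.Gamma α)) :
    P[(fun ω' => s0 (X ω')) | MeasurableSpace.comap Y inferInstance]
      =ᵐ[P] fun ω' =>
        (1 - α) * (deriv (fun x => Real.log (Real.Gamma x)) (α0 + a)
            - Real.log (β0 + b / Y ω'))
          + β * (α0 + a) / (β0 + b / Y ω') - α * Real.log β
          + Real.log (Real.Gamma α) := by
  replace hεlaw : P.map ε = volume.withDensity (inverseGammaPDF a b) := hεlaw
  have hκ := isMarkovKernel_gammaKernel (add_pos hα0 ha) hβ0 hb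
  have hYm : Measurable Y := by rw [hY]; fun_prop
  have hjoint : P.map (fun ω => (Y ω, X ω)) =
      (volume.withDensity (gammaMulInverseGammaPDF α0 β0 a b)) ⊗ₘ
        gammaKernel (α0 + a) β0 b := by
    rw [← map_prod_gamma_inverseGamma hα0 hβ0 ha hb, ← hXlaw, ← hεlaw,
      ← hindep.map_prod_eq_prod_map_map hX.aemeasurable hε.aemeasurable,
      Measure.map_map (by fun_prop) (by fun_prop), hY]
    rfl
  have hYlaw : P.map Y = volume.withDensity (gammaMulInverseGammaPDF α0 β0 a b) := by
    have hfst := congrArg Measure.fst hjoint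
    rwa [Measure.fst_compProd, Measure.fst_map_prodMk hX] at hfst
  rw [← hYlaw] at hjoint
  have hXpos : ∀ᵐ ω ∂P, 0 < X ω :=
    ae_of_ae_map hX.aemeasurable (hXlaw ▸ ae_pos_gammaMeasure α0 β0)
  have hεpos : ∀ᵐ ω ∂P, 0 < ε ω := by
    refine ae_of_ae_map hε.aemeasurable ?_
    rw [hεlaw, ae_withDensity_iff (measurable_inverseGammaPDF a b)]
    refine ae_of_all _ fun u hu => ?_
    by_contra h
    simp [inverseGammaPDF, h] at hu
  have hs0int : Integrable (fun ω => s0 (X ω)) P := by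
    have h := integrable_gammaScore_gammaMeasure hα0 hβ0 α β
    rw [← hXlaw, ← hs0] at h
    exact h.comp_measurable hX
  have hs0m : StronglyMeasurable s0 := by
    rw [hs0]
    exact Measurable.stronglyMeasurable (by fun_prop)
  have hcond := condExp_ae_eq_integral_condDistrib hYm hX.aemeasurable hs0m hs0int
  have hdistrib := ae_of_ae_map hYm.aemeasurable
    (condDistrib_ae_eq_of_measure_eq_compProd Y hX.aemeasurable hjoint)
  filter_upwards [hcond, hdistrib, hXpos, hεpos] with ω hω hdω hXω hεω
  have hYω : 0 < Y ω := by rw [hY]; exact mul_pos hXω hεω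
  rw [hω, hdω, gammaKernel_apply, abs_of_pos hYω, hs0,
    integral_gammaScore_gammaMeasure (add_pos hα0 ha) (by positivity)]
end

section
/- Let α, β > 0, let Z and Z' be independent random variables each following the gamma distribution with shape α and rate β (density f(x) = β^α/Γ(α)·x^{α−1}·exp(−β·x) on (0,∞), cdf F), and let x > 0. Then E|Z − x| − (1/2)·E|Z − Z'| = x − α/β − 1/(β·B(1/2, α)) + 2·[ (x/β)·f(x) + (α/β − x)·(1 − F(x)) ], where B denotes the Beta function. -/
open MeasureTheory ProbabilityTheory Real

namespace ProbabilityTheory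

open Set Filter Topology

variable {α β : ℝ}

lemma setIntegral_gammaMeasure (hα : 0 < α) (hβ : 0 < β) {s : Set ℝ} (hs : MeasurableSet s)
    (g : ℝ → ℝ) :
    ∫ z in s, g z ∂gammaMeasure α β = ∫ z in s, gammaPDFReal α β z * g z := by
  have hm : Measurable (gammaPDF α β) := (measurable_gammaPDFReal α β).ennreal_ofReal
  rw [gammaMeasure, restrict_withDensity hs, integral_withDensity_eq_integral_toReal_smul hm
    (ae_of_all _ fun _ => ENNReal.ofReal_lt_top)]
  refine integral_congr_ae (ae_of_all _ fun z => ?_)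
  simp [gammaPDF, ENNReal.toReal_ofReal (gammaPDFReal_nonneg hα hβ z)]

lemma gammaMeasure_restrict_Ioi_zero (α β : ℝ) :
    (gammaMeasure α β).restrict (Ioi 0) = gammaMeasure α β := by
  refine Measure.restrict_eq_self_of_ae_mem ?_
  have h : gammaMeasure α β (Iic 0) = 0 := by
    rw [gammaMeasure, withDensity_apply _ measurableSet_Iic, ← setLIntegral_congr Iio_ae_eq_Iic,
      lintegral_gammaPDF_of_nonpos le_rfl]
  filter_upwards [compl_mem_ae_iff.2 h] with z hz
  simpa using hz

lemma integral_gammaMeasure (hα : 0 < α) (hβ : 0 < β) (g : ℝ → ℝ) :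
    ∫ z, g z ∂gammaMeasure α β = ∫ z in Ioi 0, gammaPDFReal α β z * g z := by
  rw [← setIntegral_gammaMeasure hα hβ measurableSet_Ioi, gammaMeasure_restrict_Ioi_zero]

lemma integrable_gammaMeasure_iff (hα : 0 < α) (hβ : 0 < β) {g : ℝ → ℝ} :
    Integrable g (gammaMeasure α β) ↔
      IntegrableOn (fun z => gammaPDFReal α β z * g z) (Ioi 0) := by
  have hm : Measurable (gammaPDF α β) := (measurable_gammaPDFReal α β).ennreal_ofReal
  rw [← gammaMeasure_restrict_Ioi_zero, gammaMeasure, restrict_withDensity measurableSet_Ioi,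
    integrable_withDensity_iff_integrable_smul' hm (ae_of_all _ fun _ => ENNReal.ofReal_lt_top)]
  refine integrable_congr (ae_of_all _ fun z => ?_)
  simp [gammaPDF, ENNReal.toReal_ofReal (gammaPDFReal_nonneg hα hβ z)]

lemma mul_gammaPDFReal (hα : 0 < α) {t : ℝ} (ht : 0 ≤ t) :
    t * gammaPDFReal α β t = β ^ α / Gamma α * (t ^ α * exp (-(β * t))) := by
  rcases ht.eq_or_lt with rfl | ht
  · simp [zero_rpow hα.ne']
  · rw [gammaPDFReal, if_pos ht.le, rpow_sub_one ht.ne']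
    field_simp

lemma integrableOn_rpow_mul_exp_neg_mul {s b : ℝ} (hs : -1 < s) (hb : 0 < b) :
    IntegrableOn (fun t : ℝ => t ^ s * exp (-(b * t))) (Ioi 0) := by
  simpa using integrableOn_rpow_mul_exp_neg_mul_rpow hs one_pos hb

lemma integrable_id_gammaMeasure (hα : 0 < α) (hβ : 0 < β) :
    Integrable (fun z => z) (gammaMeasure α β) := by
  rw [integrable_gammaMeasure_iff hα hβ]
  refine IntegrableOn.congr_fun ((integrableOn_rpow_mul_exp_neg_mul (s := α) (by linarith)
    hβ).const_mul (β ^ α / Gamma α)) (fun t ht => ?_) measurableSet_Ioi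
  rw [mul_comm (gammaPDFReal α β t), mul_gammaPDFReal hα (le_of_lt ht)]

lemma hasDerivAt_mul_gammaPDFReal (hα : 0 < α) {t : ℝ} (ht : 0 < t) :
    HasDerivAt (fun t => t * gammaPDFReal α β t) ((α - β * t) * gammaPDFReal α β t) t := by
  have h1 : HasDerivAt (fun t : ℝ => β ^ α / Gamma α * (t ^ α * exp (-(β * t))))
      (β ^ α / Gamma α * (α * t ^ (α - 1) * exp (-(β * t))
        + t ^ α * (exp (-(β * t)) * -(β * 1)))) t :=
    ((hasDerivAt_rpow_const (Or.inl ht.ne')).mul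
      (((hasDerivAt_id t).const_mul β).neg.exp)).const_mul _
  have h2 := h1.congr_of_eventuallyEq (f₁ := fun t => t * gammaPDFReal α β t)
    ((lt_mem_nhds ht).mono fun s hs => mul_gammaPDFReal hα (le_of_lt hs))
  refine h2.congr_deriv ?_
  rw [gammaPDFReal, if_pos ht.le, rpow_sub_one ht.ne']
  field_simp
  ring

lemma tendsto_mul_gammaPDFReal_atTop (hα : 0 < α) (hβ : 0 < β) :
    Tendsto (fun t => t * gammaPDFReal α β t) atTop (𝓝 0) := by
  have h := (tendsto_rpow_mul_exp_neg_mul_atTop_nhds_zero α β hβ).const_mul (β ^ α / Gamma α)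
  rw [mul_zero] at h
  refine h.congr' ?_
  filter_upwards [eventually_ge_atTop 0] with t ht
  rw [mul_gammaPDFReal hα ht, neg_mul]

lemma continuousOn_mul_gammaPDFReal (hα : 0 < α) :
    ContinuousOn (fun t => t * gammaPDFReal α β t) (Ici 0) := by
  refine ContinuousOn.congr (f := fun t : ℝ => β ^ α / Gamma α * (t ^ α * exp (-(β * t)))) ?_
    fun t ht => mul_gammaPDFReal hα ht
  refine Continuous.continuousOn (continuous_const.mul (Continuous.mul ?_ (by fun_prop)))
  exact continuous_id.rpow_const fun _ => Or.inr hα.le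

lemma integrableOn_gammaPDFReal (hα : 0 < α) (hβ : 0 < β) :
    IntegrableOn (gammaPDFReal α β) (Ioi 0) := by
  have := isProbabilityMeasure_gammaMeasure hα hβ
  simpa using (integrable_gammaMeasure_iff hα hβ).1 (integrable_const (1 : ℝ))

lemma gammaMeasure_real_Ioi (hα : 0 < α) (hβ : 0 < β) (t : ℝ) :
    (gammaMeasure α β).real (Ioi t) = ∫ z in Ioi t, gammaPDFReal α β z := by
  simpa using setIntegral_gammaMeasure hα hβ (measurableSet_Ioi (a := t)) fun _ => 1

/-- The partial mean of the gamma distribution over `(x, ∞)`. -/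
lemma setIntegral_Ioi_id_gammaMeasure (hα : 0 < α) (hβ : 0 < β) {x : ℝ} (hx : 0 ≤ x) :
    ∫ z in Ioi x, z ∂gammaMeasure α β
      = x / β * gammaPDFReal α β x + α / β * (gammaMeasure α β).real (Ioi x) := by
  have hsub : Ioi x ⊆ Ioi 0 := Ioi_subset_Ioi hx
  have i1 := ((integrable_gammaMeasure_iff hα hβ).1
    (integrable_id_gammaMeasure hα hβ)).mono_set hsub
  have i0 := (integrableOn_gammaPDFReal hα hβ).mono_set hsub
  have h := integral_Ioi_of_hasDerivAt_of_tendsto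
    (f' := fun t => (α - β * t) * gammaPDFReal α β t)
    ((continuousOn_mul_gammaPDFReal (β := β) hα x hx).mono (Ici_subset_Ici.2 hx))
    (fun t ht => hasDerivAt_mul_gammaPDFReal hα (hx.trans_lt ht))
    (((i0.const_mul α).sub (i1.const_mul β)).congr (ae_of_all _ fun t => by
      simp only [Pi.sub_apply]; ring))
    (tendsto_mul_gammaPDFReal_atTop hα hβ)
  rw [setIntegral_gammaMeasure hα hβ measurableSet_Ioi, gammaMeasure_real_Ioi hα hβ]
  have h2 : ∫ t in Ioi x, (α - β * t) * gammaPDFReal α β t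
      = α * (∫ t in Ioi x, gammaPDFReal α β t) - β * ∫ t in Ioi x, gammaPDFReal α β t * t := by
    rw [← integral_const_mul, ← integral_const_mul,
      ← integral_sub (i0.const_mul α) (i1.const_mul β)]
    exact integral_congr_ae (ae_of_all _ fun t => by ring)
  rw [h2] at h
  field_simp
  linarith

lemma integral_id_gammaMeasure (hα : 0 < α) (hβ : 0 < β) :
    ∫ z, z ∂gammaMeasure α β = α / β := by
  have := isProbabilityMeasure_gammaMeasure hα hβ
  have h1 : (gammaMeasure α β).real (Ioi 0) = 1 := by
    rw [← measureReal_restrict_apply_univ, gammaMeasure_restrict_Ioi_zero, probReal_univ]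
  have h := setIntegral_Ioi_id_gammaMeasure hα hβ le_rfl
  rw [gammaMeasure_restrict_Ioi_zero, h1] at h
  simpa using h

/-- The mean absolute deviation of the gamma distribution from a point `x ≥ 0`. -/
lemma integral_abs_sub_gammaMeasure (hα : 0 < α) (hβ : 0 < β) {x : ℝ} (hx : 0 ≤ x) :
    ∫ z, |z - x| ∂gammaMeasure α β = x - α / β
      + 2 * (x / β * gammaPDFReal α β x + (α / β - x) * (gammaMeasure α β).real (Ioi x)) := by
  have := isProbabilityMeasure_gammaMeasure hα hβ
  have i1 := integrable_id_gammaMeasure hα hβ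
  have i2 : Integrable (fun z => z - x) (gammaMeasure α β) := i1.sub (integrable_const x)
  have hpt : ∀ z : ℝ, |z - x| = 2 * (Ioi x).indicator (fun z => z - x) z - (z - x) := by
    intro z
    by_cases hz : x < z
    · rw [indicator_of_mem (mem_Ioi.2 hz), abs_of_pos (by linarith)]
      ring
    · rw [indicator_of_notMem (by simpa using hz), abs_of_nonpos (by linarith)]
      ring
  simp_rw [hpt]
  rw [integral_sub ((i2.indicator measurableSet_Ioi).const_mul 2) i2, integral_const_mul,
    integral_indicator measurableSet_Ioi, integral_sub i1.integrableOn (integrable_const x),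
    integral_sub i1 (integrable_const x), setIntegral_Ioi_id_gammaMeasure hα hβ hx,
    integral_id_gammaMeasure hα hβ]
  simp
  ring

lemma hasDerivAt_gammaMeasure_real_Ioi (hα : 0 < α) (hβ : 0 < β) {t : ℝ} (ht : 0 < t) :
    HasDerivAt (fun t => (gammaMeasure α β).real (Ioi t)) (-gammaPDFReal α β t) t := by
  have i0 := integrableOn_gammaPDFReal hα hβ
  have hint : IntervalIntegrable (gammaPDFReal α β) volume 0 t :=
    (intervalIntegrable_iff_integrableOn_Ioc_of_le ht.le).2 (i0.mono_set Ioc_subset_Ioi_self)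
  have hc : ContinuousAt (gammaPDFReal α β) t := by
    refine ((hasDerivAt_mul_gammaPDFReal (β := β) hα ht).continuousAt.div continuousAt_id
      ht.ne').congr ?_
    filter_upwards [lt_mem_nhds ht] with s hs
    simp [hs.ne']
  have h := (intervalIntegral.integral_hasDerivAt_right hint
    (stronglyMeasurable_gammaPDFReal α β).stronglyMeasurableAtFilter hc).const_sub
    (∫ z in Ioi 0, gammaPDFReal α β z)
  refine h.congr_of_eventuallyEq ?_
  filter_upwards [lt_mem_nhds ht] with s hs
  rw [gammaMeasure_real_Ioi hα hβ, ← intervalIntegral.integral_Ioi_sub_Ioi i0 hs.le]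
  ring

lemma gammaPDFReal_mul_mul_gammaPDFReal (hα : 0 < α) {t : ℝ} (ht : 0 < t) :
    gammaPDFReal α β t * (t * gammaPDFReal α β t)
      = (β ^ α / Gamma α) ^ 2 * (t ^ (2 * α - 1) * exp (-(2 * β * t))) := by
  rw [mul_gammaPDFReal hα ht.le, gammaPDFReal, if_pos ht.le,
    show 2 * α - 1 = (α - 1) + α by ring, rpow_add ht,
    show -(2 * β * t) = -(β * t) + -(β * t) by ring, exp_add]
  ring

lemma integrable_mul_gammaPDFReal (hα : 0 < α) (hβ : 0 < β) :
    Integrable (fun t => t * gammaPDFReal α β t) (gammaMeasure α β) := by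
  rw [integrable_gammaMeasure_iff hα hβ]
  exact IntegrableOn.congr_fun ((integrableOn_rpow_mul_exp_neg_mul (s := 2 * α - 1) (b := 2 * β)
    (by linarith) (by linarith)).const_mul ((β ^ α / Gamma α) ^ 2))
    (fun t ht => (gammaPDFReal_mul_mul_gammaPDFReal hα ht).symm) measurableSet_Ioi

lemma integral_mul_gammaPDFReal (hα : 0 < α) (hβ : 0 < β) :
    ∫ t, t * gammaPDFReal α β t ∂gammaMeasure α β = 1 / (2 * beta (1 / 2) α) := by
  rw [integral_gammaMeasure hα hβ, setIntegral_congr_fun measurableSet_Ioi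
    (fun t ht => gammaPDFReal_mul_mul_gammaPDFReal hα ht), integral_const_mul,
    integral_rpow_mul_exp_neg_mul_Ioi (by linarith) (by linarith), beta, Gamma_one_half_eq,
    add_comm (1 / 2) α]
  have hd := Gamma_mul_Gamma_add_half α
  have hG := Gamma_pos_of_pos hα
  have hG2 := Gamma_pos_of_pos (show 0 < α + 1 / 2 by linarith)
  have e1 : (1 / (2 * β)) ^ (2 * α) = ((2 : ℝ) ^ (2 * α) * (β ^ α) ^ 2)⁻¹ := by
    rw [one_div, inv_rpow (by positivity), mul_rpow zero_le_two hβ.le, ← rpow_natCast (β ^ α) 2,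
      ← rpow_mul hβ.le]
    norm_num [mul_comm]
  have e2 : (2 : ℝ) ^ (1 - 2 * α) = 2 / 2 ^ (2 * α) := by
    rw [rpow_sub two_pos, rpow_one]
  have hp : (0 : ℝ) < 2 ^ (2 * α) := by positivity
  have hb : 0 < β ^ α := by positivity
  have hs : √π ≠ 0 := by positivity
  rw [e2] at hd
  rw [e1]
  field_simp at hd ⊢
  linarith

lemma integral_mul_gammaMeasure_real_Ioi (hα : 0 < α) (hβ : 0 < β) :
    Integrable (fun t => (α / β - t) * (gammaMeasure α β).real (Ioi t)) (gammaMeasure α β) ∧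
    ∫ t, (α / β - t) * (gammaMeasure α β).real (Ioi t) ∂gammaMeasure α β
      = 1 / β * ∫ t, t * gammaPDFReal α β t ∂gammaMeasure α β := by
  have := isProbabilityMeasure_gammaMeasure hα hβ
  set S := fun t => (gammaMeasure α β).real (Ioi t) with hS
  have hSb : ∀ t, ‖S t‖ ≤ 1 := fun t => by
    rw [norm_of_nonneg measureReal_nonneg]; exact measureReal_le_one
  have hanti : Antitone S := fun a b hab => measureReal_mono (Ioi_subset_Ioi hab)
  have iS : Integrable (fun t => (α / β - t) * S t) (gammaMeasure α β) :=
    ((integrable_const (α / β)).sub (integrable_id_gammaMeasure hα hβ)).mul_bdd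
      hanti.measurable.aestronglyMeasurable (ae_of_all _ hSb)
  refine ⟨iS, ?_⟩
  have iT := integrable_mul_gammaPDFReal hα hβ
  have jS := ((integrable_gammaMeasure_iff hα hβ).1 iS).const_mul β
  have jT := (integrable_gammaMeasure_iff hα hβ).1 iT
  have hfun : ∀ t, (α - β * t) * gammaPDFReal α β t * S t
      + t * gammaPDFReal α β t * -gammaPDFReal α β t
      = β * (gammaPDFReal α β t * ((α / β - t) * S t))
        - gammaPDFReal α β t * (t * gammaPDFReal α β t) := by
    intro t; field_simp; ring
  have hle : ∀ t, ‖t * gammaPDFReal α β t * S t‖ ≤ ‖t * gammaPDFReal α β t‖ := fun t => by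
    rw [norm_mul]
    exact mul_le_of_le_one_right (norm_nonneg _) (hSb t)
  have h0 : Tendsto (fun t => t * gammaPDFReal α β t) (𝓝[>] 0) (𝓝 0) := by
    simpa using! ((continuousOn_mul_gammaPDFReal (β := β) hα 0 self_mem_Ici).mono
      Ioi_subset_Ici_self).tendsto
  have h := integral_Ioi_deriv_mul_eq_sub (a := 0) (a' := 0) (b' := 0)
    (fun t ht => hasDerivAt_mul_gammaPDFReal (β := β) hα ht)
    (fun t ht => hasDerivAt_gammaMeasure_real_Ioi hα hβ ht)
    ((jS.sub jT).congr (ae_of_all _ fun t => (hfun t).symm))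
    (squeeze_zero_norm hle (by simpa using h0.norm))
    (squeeze_zero_norm hle (by simpa using (tendsto_mul_gammaPDFReal_atTop hα hβ).norm))
  rw [integral_congr_ae (ae_of_all _ hfun), integral_sub jS jT, integral_const_mul,
    ← integral_gammaMeasure hα hβ, ← integral_gammaMeasure hα hβ] at h
  rw [one_div, eq_inv_mul_iff_mul_eq₀ hβ.ne']
  linarith

/-- The mean absolute difference of two independent gamma variables. -/
lemma integral_prod_abs_sub_gammaMeasure (hα : 0 < α) (hβ : 0 < β) :
    ∫ p : ℝ × ℝ, |p.1 - p.2| ∂(gammaMeasure α β).prod (gammaMeasure α β)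
      = 2 / (β * beta (1 / 2) α) := by
  have := isProbabilityMeasure_gammaMeasure hα hβ
  have i1 := integrable_id_gammaMeasure hα hβ
  obtain ⟨iS, hS⟩ := integral_mul_gammaMeasure_real_Ioi hα hβ
  have iT := integrable_mul_gammaPDFReal hα hβ
  have ip : Integrable (fun p : ℝ × ℝ => |p.1 - p.2|)
      ((gammaMeasure α β).prod (gammaMeasure α β)) := ((i1.comp_fst _).sub (i1.comp_snd _)).abs
  rw [integral_prod_symm _ ip]
  have hae : ∀ᵐ t ∂gammaMeasure α β, ∫ z, |z - t| ∂gammaMeasure α β = t - α / β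
      + (2 / β * (t * gammaPDFReal α β t)
        + 2 * ((α / β - t) * (gammaMeasure α β).real (Ioi t))) := by
    rw [← gammaMeasure_restrict_Ioi_zero α β]
    refine (ae_restrict_iff' measurableSet_Ioi).2 (ae_of_all _ fun t ht => ?_)
    rw [gammaMeasure_restrict_Ioi_zero, integral_abs_sub_gammaMeasure hα hβ (le_of_lt ht)]
    ring
  have ic : Integrable (fun t => t - α / β) (gammaMeasure α β) := i1.sub (integrable_const _)
  have iTS : Integrable (fun t => 2 / β * (t * gammaPDFReal α β t)
      + 2 * ((α / β - t) * (gammaMeasure α β).real (Ioi t))) (gammaMeasure α β) :=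
    (iT.const_mul _).add (iS.const_mul _)
  rw [integral_congr_ae hae, integral_add ic iTS, integral_sub i1 (integrable_const _),
    integral_add (iT.const_mul _) (iS.const_mul _), integral_const_mul, integral_const_mul, hS,
    integral_id_gammaMeasure hα hβ, integral_mul_gammaPDFReal hα hβ]
  have hB := beta_pos (show (0 : ℝ) < 1 / 2 by norm_num) hα
  simp only [integral_const, probReal_univ, one_smul]
  field_simp
  ring

end ProbabilityTheory

/-- Closed form of the CRPS for a gamma forecast with shape `α` and rate `β`:
`E|Z − x| − (1/2)E|Z − Z'| = x − α/β − 1/(β·B(1/2, α)) + 2·[(x/β)·f(x) + (α/β − x)·(1 − F(x))]`,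
where `f` and `F` are the gamma pdf and cdf and `B` is the Beta function. -/
theorem stmt17 {Ω : Type*} [MeasurableSpace Ω] (P : Measure Ω) [IsProbabilityMeasure P]
    (Z Z' : Ω → ℝ) (α β : ℝ) (hα : 0 < α) (hβ : 0 < β) (x : ℝ) (hx : 0 < x)
    (hZ : P.map Z = gammaMeasure α β) (hZ' : P.map Z' = gammaMeasure α β)
    (hindep : IndepFun Z Z' P)
    (f F : ℝ → ℝ) (B : ℝ → ℝ → ℝ)
    (hf : f = gammaPDFReal α β)
    (hF : F = fun t => (gammaMeasure α β (Set.Iic t)).toReal)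
    (hB : B = fun p q => Real.Gamma p * Real.Gamma q / Real.Gamma (p + q)) :
    (∫ ω, |Z ω - x| ∂P) - (1 / 2) * ∫ ω, |Z ω - Z' ω| ∂P
      = x - α / β - 1 / (β * B (1 / 2) α)
        + 2 * ((x / β) * f x + (α / β - x) * (1 - F x)) := by
  have := isProbabilityMeasure_gammaMeasure hα hβ
  have mZ : AEMeasurable Z P := aemeasurable_of_map_neZero (by rw [hZ]; infer_instance)
  have mZ' : AEMeasurable Z' P := aemeasurable_of_map_neZero (by rw [hZ']; infer_instance)
  have h1 : ∫ ω, |Z ω - x| ∂P = ∫ z, |z - x| ∂gammaMeasure α β := by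
    rw [← hZ, integral_map mZ (by fun_prop)]
  have h2 : ∫ ω, |Z ω - Z' ω| ∂P
      = ∫ p : ℝ × ℝ, |p.1 - p.2| ∂(gammaMeasure α β).prod (gammaMeasure α β) := by
    have hprod := (indepFun_iff_map_prod_eq_prod_map_map mZ mZ').1 hindep
    rw [hZ, hZ'] at hprod
    rw [← hprod, integral_map (mZ.prodMk mZ') (by fun_prop)]
  have h3 : (gammaMeasure α β).real (Set.Ioi x) = 1 - F x := by
    rw [hF, ← Set.compl_Iic, probReal_compl_eq_one_sub measurableSet_Iic, measureReal_def]
  have h4 : B (1 / 2) α = beta (1 / 2) α := by rw [hB, beta]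
  have hB0 := beta_pos (show (0 : ℝ) < 1 / 2 by norm_num) hα
  rw [h1, h2, integral_abs_sub_gammaMeasure hα hβ hx.le,
    integral_prod_abs_sub_gammaMeasure hα hβ, h3, h4, hf]
  field_simp
  ring
end
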